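/- Let T be a finite rooted binary tree with leaf assignment χ and maximum path decomposition P_max(T), let U be a connected component of the shrub forest of unsupported short paths, and fix a path p ∈ U with p ≠ r(U). Suppose that for all q, q' ∈ U_p with q the parent of q' in U we have W_q ≥ (4/3)·W_{q'}. Then Σ_{q ∈ U_p} |q| ≤ W_p/20. -/

import Mathlib

open scoped Classical
noncomputable section

/-- A finite rooted binary tree on vertex set `V`: every non-root vertex has a parent,
the root has none, depths are consistent (ensuring acyclicity), and each vertex has
at most two children. -/
structure RBTree (V : Type) [Fintype V] [DecidableEq V] where
  parent : V → Option V
  root : V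
  depth : V → ℕ
  parent_root : parent root = none
  root_of_parent_none : ∀ v, parent v = none → v = root
  depth_parent : ∀ v u, parent v = some u → depth v = depth u + 1
  binary : ∀ v : V, (Finset.univ.filter (fun c => parent c = some v)).card ≤ 2

namespace RBTree

variable {V : Type} [Fintype V] [DecidableEq V]

/-- The children of a vertex. -/
def children (T : RBTree V) (v : V) : Finset V :=
  Finset.univ.filter (fun c => T.parent c = some v)

/-- A leaf is a vertex with no children. -/
def IsLeaf (T : RBTree V) (v : V) : Prop := T.children v = ∅

/-- Iterated parent map. -/
def parentIter (T : RBTree V) : ℕ → V → Option V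
  | 0, v => some v
  | n + 1, v => (T.parentIter n v).bind T.parent

/-- `u` is a (weak) ancestor of `v`: `u` lies on the path from `v` to the root
(including `v` itself). -/
def Anc (T : RBTree V) (u v : V) : Prop := ∃ n, T.parentIter n v = some u

/-- `u` is a strict ancestor of `v`. -/
def StrictAnc (T : RBTree V) (u v : V) : Prop := ∃ n, 0 < n ∧ T.parentIter n v = some u

/-- `L(T_v)`: the leaves of the subtree rooted at `v`. -/
def subtreeLeaves (T : RBTree V) (v : V) : Finset V :=
  Finset.univ.filter (fun l => T.IsLeaf l ∧ T.Anc v l)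

/-- A leaf assignment `χ` assigns to each internal vertex a set of leaves containing
exactly one leaf from the subtree of each of its children (and nothing else);
leaves are assigned the empty set. -/
structure LeafAssignment (T : RBTree V) where
  χ : V → Finset V
  mem_leaf : ∀ v l, l ∈ χ v → T.IsLeaf l
  mem_desc : ∀ v l, l ∈ χ v → ∃ c ∈ T.children v, T.Anc c l
  unique_child : ∀ v, ∀ c ∈ T.children v, ∃! l, l ∈ χ v ∧ T.Anc c l

/-- The heap `H_v = {u ∈ A(v) : χ(u) ∩ L(T_v) ≠ ∅}` of a vertex `v`. -/
def heap (T : RBTree V) (A : T.LeafAssignment) (v : V) : Finset V :=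
  Finset.univ.filter (fun u => T.StrictAnc u v ∧ (A.χ u ∩ T.subtreeLeaves v).Nonempty)

/-- A leaf path: the set of vertices on a monotone path from some leaf `ℓ` up to an
ancestor `b` of `ℓ`. -/
def IsLeafPath (T : RBTree V) (p : Finset V) : Prop :=
  ∃ ℓ b, T.IsLeaf ℓ ∧ T.Anc b ℓ ∧
    p = Finset.univ.filter (fun u => T.Anc u ℓ ∧ T.Anc b u)

/-- The base `b(p)` of a path: its vertex closest to the root. -/
def base (T : RBTree V) (p : Finset V) : V :=
  if h : ∃ b, b ∈ p ∧ ∀ w ∈ p, T.Anc b w then h.choose else T.root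

/-- The leaf `ℓ(p)` of a path. -/
def pathLeaf (T : RBTree V) (p : Finset V) : V :=
  if h : ∃ l, l ∈ p ∧ ∀ w ∈ p, T.Anc w l then h.choose else T.root

/-- `H_p = H_{b(p)}`. -/
def pathHeap (T : RBTree V) (A : T.LeafAssignment) (p : Finset V) : Finset V :=
  T.heap A (T.base p)

/-- A path decomposition: a partition of the vertex set into leaf paths. -/
def IsPathDecomp (T : RBTree V) (P : Finset (Finset V)) : Prop :=
  (∀ p ∈ P, T.IsLeafPath p) ∧ (∀ v : V, ∃! p, p ∈ P ∧ v ∈ p)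

/-- `q` is a child of `p` in the shrub: the parent of `b(q)` lies on `p`. -/
def ShrubParent (T : RBTree V) (p q : Finset V) : Prop :=
  ∃ u, T.parent (T.base q) = some u ∧ u ∈ p

/-- `p` is a strict ancestor of `q` in the shrub: some vertex of `p` is a strict
ancestor of `b(q)` in `T` (and `p ≠ q`). -/
def ShrubStrictAnc (T : RBTree V) (p q : Finset V) : Prop :=
  p ≠ q ∧ ∃ u ∈ p, T.StrictAnc u (T.base q)

/-- Weak ancestor relation in the shrub. -/
def ShrubAnc (T : RBTree V) (p q : Finset V) : Prop :=
  p = q ∨ T.ShrubStrictAnc p q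

/-- A maximum path decomposition w.r.t. a leaf assignment: a path decomposition in
which each internal vertex lies on the same path as a child of maximal heap size. -/
def IsMaxPathDecomp (T : RBTree V) (A : T.LeafAssignment) (P : Finset (Finset V)) : Prop :=
  T.IsPathDecomp P ∧
    ∀ p ∈ P, ∀ v ∈ p, ∀ c ∈ T.children v, c ∈ p →
      ∀ c' ∈ T.children v, (T.heap A c').card ≤ (T.heap A c).card

/-- A path `p` is short if `|p| < sqrt(|H_p|)/100`. -/
def IsShort (T : RBTree V) (A : T.LeafAssignment) (p : Finset V) : Prop :=
  (p.card : ℝ) < Real.sqrt ((T.pathHeap A p).card) / 100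

/-- The tall support chain of a path `p`: the maximal chain of tall paths in the shrub
starting at the parent of `p` and going up. -/
def TallChain (T : RBTree V) (A : T.LeafAssignment) (P : Finset (Finset V)) (p : Finset V) :
    Finset (Finset V) :=
  P.filter (fun q => T.ShrubStrictAnc q p ∧
    ∀ r ∈ P, T.ShrubStrictAnc r p → T.ShrubAnc q r → ¬ T.IsShort A r)

/-- A short path is supported if at least `|H_p|/100` of the vertices of `H_p` lie on
paths of its tall support chain. -/
def IsSupported (T : RBTree V) (A : T.LeafAssignment) (P : Finset (Finset V))
    (p : Finset V) : Prop :=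
  ((T.pathHeap A p).card : ℝ) / 100 ≤
    (((T.pathHeap A p).filter (fun v => ∃ q ∈ T.TallChain A P p, v ∈ q)).card : ℝ)

/-- The reduced heap `H̃_p`: vertices of `H_p` not lying on the tall support chain. -/
def redHeap (T : RBTree V) (A : T.LeafAssignment) (P : Finset (Finset V))
    (p : Finset V) : Finset V :=
  (T.pathHeap A p).filter (fun v => ∀ q ∈ T.TallChain A P p, v ∉ q)

/-- `q` is the parent of the unsupported short path `p` in the shrub forest of
unsupported short paths: `q` is the first short path on the chain of strict shrub
ancestors of `p`. -/
def ForestParent (T : RBTree V) (A : T.LeafAssignment) (P : Finset (Finset V))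
    (q p : Finset V) : Prop :=
  q ∈ P ∧ p ∈ P ∧ T.IsShort A q ∧ T.IsShort A p ∧ ¬ T.IsSupported A P p ∧
    T.ShrubStrictAnc q p ∧
    ∀ r ∈ P, T.ShrubStrictAnc r p → T.ShrubStrictAnc q r → ¬ T.IsShort A r

/-- `U` is the connected component of the shrub forest of unsupported short paths
rooted at the supported short path `r`. -/
def IsComponent (T : RBTree V) (A : T.LeafAssignment) (P : Finset (Finset V))
    (U : Finset (Finset V)) (r : Finset V) : Prop :=
  U ⊆ P ∧ r ∈ U ∧ T.IsShort A r ∧ T.IsSupported A P r ∧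
    (∀ p ∈ U, T.IsShort A p) ∧
    (∀ p ∈ U, p ≠ r → ¬ T.IsSupported A P p) ∧
    (∀ p ∈ U, p ≠ r → ∃ q ∈ U, T.ForestParent A P q p) ∧
    (∀ q ∈ U, ∀ p ∈ P, T.ForestParent A P q p → p ∈ U)

/-- `q` lies in the subtree of the shrub forest rooted at `p`. -/
def ForestDesc (T : RBTree V) (A : T.LeafAssignment) (P : Finset (Finset V))
    (p q : Finset V) : Prop :=
  Relation.ReflTransGen (fun a b => T.ForestParent A P a b) p q

/-- `U_p`: the nodes of `U` in the subtree of the shrub forest rooted at `p`. -/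
def usub (T : RBTree V) (A : T.LeafAssignment) (P : Finset (Finset V))
    (U : Finset (Finset V)) (p : Finset V) : Finset (Finset V) :=
  U.filter (fun q => T.ForestDesc A P p q)

/-- The children of `p` in the shrub forest (within `U`). -/
def forestChildren (T : RBTree V) (A : T.LeafAssignment) (P : Finset (Finset V))
    (U : Finset (Finset V)) (p : Finset V) : Finset (Finset V) :=
  U.filter (fun q => T.ForestParent A P p q)

/-- The residue `R_p = |H̃_p| − Σ_{q child of p} |H̃_q|`. -/
def residue (T : RBTree V) (A : T.LeafAssignment) (P : Finset (Finset V))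
    (U : Finset (Finset V)) (p : Finset V) : ℤ :=
  ((T.redHeap A P p).card : ℤ) -
    ∑ q ∈ T.forestChildren A P U p, ((T.redHeap A P q).card : ℤ)

/-- `R⁺_p = max(R_p, 0)`. -/
def resPlus (T : RBTree V) (A : T.LeafAssignment) (P : Finset (Finset V))
    (U : Finset (Finset V)) (p : Finset V) : ℤ :=
  max (T.residue A P U p) 0

/-- The weight `W_p = Σ_{q ∈ U_p} R⁺_q`. -/
def weight (T : RBTree V) (A : T.LeafAssignment) (P : Finset (Finset V))
    (U : Finset (Finset V)) (p : Finset V) : ℤ :=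
  ∑ q ∈ T.usub A P U p, T.resPlus A P U q

variable {T : RBTree V} {A : T.LeafAssignment} {P U : Finset (Finset V)}

theorem parentIter_add (m n : ℕ) (v : V) :
    T.parentIter (m + n) v = (T.parentIter m v).bind (T.parentIter n) := by
  induction n with
  | zero => cases h : T.parentIter m v <;> simp [parentIter]
  | succ n ih =>
    rw [← Nat.add_assoc, parentIter, ih, Option.bind_assoc]
    rfl

theorem depth_of_parentIter {n : ℕ} {v u : V} (h : T.parentIter n v = some u) :
    T.depth v = T.depth u + n := by
  induction n generalizing u with
  | zero => simp_all [parentIter]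
  | succ n ih =>
    obtain ⟨w, hw, hwu⟩ := Option.bind_eq_some_iff.mp h
    have := ih hw
    have := T.depth_parent w u hwu
    omega

theorem Anc.trans {u v w : V} (h₁ : T.Anc u v) (h₂ : T.Anc v w) : T.Anc u w := by
  obtain ⟨m, hm⟩ := h₁
  obtain ⟨n, hn⟩ := h₂
  exact ⟨n + m, by rw [parentIter_add, hn, Option.bind_some, hm]⟩

theorem Anc.depth_le {u v : V} (h : T.Anc u v) : T.depth u ≤ T.depth v := by
  obtain ⟨n, hn⟩ := h
  have := depth_of_parentIter hn
  omega

theorem StrictAnc.anc {u v : V} (h : T.StrictAnc u v) : T.Anc u v :=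
  h.imp fun _ hn => hn.2

theorem StrictAnc.depth_lt {u v : V} (h : T.StrictAnc u v) : T.depth u < T.depth v := by
  obtain ⟨n, h0, hn⟩ := h
  have := depth_of_parentIter hn
  omega

theorem anc_refl (T : RBTree V) (v : V) : T.Anc v v := ⟨0, rfl⟩

/-- Two ancestors of a common vertex are comparable. -/
theorem Anc.strictAnc_or_anc {u v w : V} (hu : T.Anc u w) (hv : T.Anc v w) :
    T.StrictAnc u v ∨ T.Anc v u := by
  obtain ⟨m, hm⟩ := hu
  obtain ⟨n, hn⟩ := hv
  rcases lt_or_ge n m with h | h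
  · obtain ⟨k, rfl⟩ := Nat.exists_eq_add_of_lt h
    rw [Nat.add_assoc, parentIter_add, hn, Option.bind_some] at hm
    exact Or.inl ⟨k + 1, k.succ_pos, hm⟩
  · obtain ⟨k, rfl⟩ := Nat.exists_eq_add_of_le h
    rw [parentIter_add, hm, Option.bind_some] at hn
    exact Or.inr ⟨k, hn⟩

theorem IsLeafPath.base_spec {p : Finset V} (hp : T.IsLeafPath p) :
    T.base p ∈ p ∧ ∀ w ∈ p, T.Anc (T.base p) w := by
  have h : ∃ b, b ∈ p ∧ ∀ w ∈ p, T.Anc b w := by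
    obtain ⟨l, b, -, hbl, rfl⟩ := hp
    exact ⟨b, by simp [hbl, anc_refl], fun w hw => (Finset.mem_filter.mp hw).2.2⟩
  rw [base, dif_pos h]
  exact h.choose_spec

theorem IsLeafPath.mem_of_anc {p : Finset V} (hp : T.IsLeafPath p) {u x : V} (hu : u ∈ p)
    (hxu : T.Anc x u) (hbx : T.Anc (T.base p) x) : x ∈ p := by
  have hb := hp.base_spec.1
  obtain ⟨l, b, -, -, rfl⟩ := hp
  simp only [Finset.mem_filter, Finset.mem_univ, true_and] at hb hu ⊢
  exact ⟨hxu.trans hu.1, hb.2.trans hbx⟩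

theorem ForestParent.depth_base_lt (hP : T.IsPathDecomp P) {q p : Finset V}
    (h : T.ForestParent A P q p) : T.depth (T.base q) < T.depth (T.base p) := by
  obtain ⟨hq, -, -, -, -, ⟨-, u, hu, hup⟩, -⟩ := h
  exact (((hP.1 q hq).base_spec.2 u hu).depth_le).trans_lt hup.depth_lt

theorem ForestDesc.depth_base_le (hP : T.IsPathDecomp P) {q p : Finset V}
    (h : T.ForestDesc A P q p) : T.depth (T.base q) ≤ T.depth (T.base p) := by
  induction h with
  | refl => exact le_rfl
  | tail _ h ih => exact ih.trans (h.depth_base_lt hP).le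

theorem ForestParent.unique (hP : T.IsPathDecomp P) {q q' p : Finset V}
    (h : T.ForestParent A P q p) (h' : T.ForestParent A P q' p) : q = q' := by
  obtain ⟨hq, -, hqs, -, -, hqp, hmin⟩ := h
  obtain ⟨hq', -, hqs', -, -, hqp', hmin'⟩ := h'
  have key : ∀ a ∈ P, ∀ b ∈ P, a ≠ b → T.ShrubStrictAnc b p → T.IsShort A b →
      (∀ r ∈ P, T.ShrubStrictAnc r p → T.ShrubStrictAnc a r → ¬ T.IsShort A r) →
      ∀ u ∈ a, ∀ v ∈ b, T.Anc u v → False := by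
    intro a ha b hb hab hbp hbs hm u hu v hv huv
    rcases huv.strictAnc_or_anc ((hP.1 b hb).base_spec.2 v hv) with h | h
    · exact hm b hb hbp ⟨hab, u, hu, h⟩ hbs
    · exact hab ((hP.2 u).unique ⟨ha, hu⟩ ⟨hb, (hP.1 b hb).mem_of_anc hv huv h⟩)
  by_contra hne
  obtain ⟨-, u, hu, hup⟩ := id hqp
  obtain ⟨-, u', hu', hup'⟩ := id hqp'
  rcases hup.anc.strictAnc_or_anc hup'.anc with h | h
  · exact key q hq q' hq' hne hqp' hqs' hmin u hu u' hu' h.anc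
  · exact key q' hq' q hq (Ne.symm hne) hqp hqs hmin' u' hu' u hu h

theorem ForestDesc.eq_of_common (hP : T.IsPathDecomp P) {q c c' s : Finset V}
    (hc : T.ForestParent A P q c) (hc' : T.ForestParent A P q c')
    (hs : T.ForestDesc A P c s) (hs' : T.ForestDesc A P c' s) : c = c' := by
  have key : ∀ a b, T.ForestParent A P q a → T.ForestParent A P q b →
      T.ForestDesc A P a b → a = b := by
    intro a b ha hb hab
    rcases Relation.ReflTransGen.cases_tail hab with h | ⟨d, had, hdb⟩
    · exact h.symm
    · obtain rfl := hdb.unique hP hb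
      exact absurd (ForestDesc.depth_base_le hP had) (ha.depth_base_lt hP).not_ge
  have htot := Relation.ReflTransGen.total_of_right_unique
    (r := Function.swap (T.ForestParent A P)) (fun _ _ _ h h' => h.unique hP h')
    (Relation.reflTransGen_swap.mpr hs) (Relation.reflTransGen_swap.mpr hs')
  rcases htot with h | h
  · exact (key c' c hc' hc (Relation.reflTransGen_swap.mp h)).symm
  · exact key c c' hc hc' (Relation.reflTransGen_swap.mp h)

theorem notMem_biUnion_usub (hP : T.IsPathDecomp P) (q : Finset V) :
    q ∉ (T.forestChildren A P U q).biUnion (T.usub A P U) := by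
  simp only [Finset.mem_biUnion, forestChildren, usub, Finset.mem_filter, not_exists, not_and]
  rintro c ⟨-, hc⟩ - hd
  exact absurd (ForestDesc.depth_base_le hP hd) (hc.depth_base_lt hP).not_ge

theorem usub_eq_insert (hclosed : ∀ q ∈ U, ∀ p ∈ P, T.ForestParent A P q p → p ∈ U)
    {q : Finset V} (hq : q ∈ U) :
    T.usub A P U q = insert q ((T.forestChildren A P U q).biUnion (T.usub A P U)) := by
  ext s
  simp only [Finset.mem_insert, Finset.mem_biUnion, forestChildren, usub, Finset.mem_filter]
  constructor
  · rintro ⟨hs, hqs⟩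
    rcases Relation.ReflTransGen.cases_head hqs with h | ⟨c, hqc, hcs⟩
    · exact Or.inl h.symm
    · exact Or.inr ⟨c, ⟨hclosed q hq c hqc.2.1 hqc, hqc⟩, hs, hcs⟩
  · rintro (rfl | ⟨c, ⟨-, hqc⟩, hs, hcs⟩)
    · exact ⟨hq, .refl⟩
    · exact ⟨hs, .head hqc hcs⟩

/-- A sum over `U_q` splits into the term of `q` and the sums over the `U_c`, `c` a child. -/
theorem sum_usub {M : Type*} [AddCommMonoid M] (hP : T.IsPathDecomp P)
    (hclosed : ∀ q ∈ U, ∀ p ∈ P, T.ForestParent A P q p → p ∈ U)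
    {q : Finset V} (hq : q ∈ U) (f : Finset V → M) :
    ∑ s ∈ T.usub A P U q, f s =
      f q + ∑ c ∈ T.forestChildren A P U q, ∑ s ∈ T.usub A P U c, f s := by
  rw [usub_eq_insert hclosed hq, Finset.sum_insert (notMem_biUnion_usub hP q),
    Finset.sum_biUnion]
  intro c hc c' hc' hne
  refine Finset.disjoint_left.mpr fun s hs hs' => hne ?_
  exact ForestDesc.eq_of_common hP (Finset.mem_filter.mp hc).2 (Finset.mem_filter.mp hc').2
    (Finset.mem_filter.mp hs).2 (Finset.mem_filter.mp hs').2

theorem forest_induction (hP : T.IsPathDecomp P)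
    (hclosed : ∀ q ∈ U, ∀ p ∈ P, T.ForestParent A P q p → p ∈ U) {motive : Finset V → Prop}
    (step : ∀ q ∈ U, (∀ c ∈ T.forestChildren A P U q, motive c) → motive q)
    (q : Finset V) (hq : q ∈ U) : motive q := by
  induction h : (T.usub A P U q).card using Nat.strong_induction_on generalizing q with
  | _ n ih =>
    subst h
    refine step q hq fun c hc => ih _ (Finset.card_lt_card ?_) c (Finset.mem_filter.mp hc).1 rfl
    have hsub := Finset.subset_biUnion_of_mem (T.usub A P U) hc
    rw [usub_eq_insert hclosed hq]
    exact hsub.trans_ssubset (Finset.ssubset_insert (notMem_biUnion_usub hP q))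

theorem weight_eq (hP : T.IsPathDecomp P)
    (hclosed : ∀ q ∈ U, ∀ p ∈ P, T.ForestParent A P q p → p ∈ U)
    {q : Finset V} (hq : q ∈ U) :
    T.weight A P U q =
      T.resPlus A P U q + ∑ c ∈ T.forestChildren A P U q, T.weight A P U c :=
  sum_usub hP hclosed hq _

theorem card_redHeap_le_weight (hP : T.IsPathDecomp P)
    (hclosed : ∀ q ∈ U, ∀ p ∈ P, T.ForestParent A P q p → p ∈ U)
    {q : Finset V} (hq : q ∈ U) : ((T.redHeap A P q).card : ℤ) ≤ T.weight A P U q := by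
  refine forest_induction (motive := fun q => ((T.redHeap A P q).card : ℤ) ≤ T.weight A P U q)
    hP hclosed (fun q hq ih => ?_) q hq
  rw [weight_eq hP hclosed hq]
  have h₁ := Finset.sum_le_sum ih
  have h₂ : T.residue A P U q ≤ T.resPlus A P U q := le_max_left _ _
  rw [residue] at h₂
  linarith

theorem sum_weight_children_le (hP : T.IsPathDecomp P)
    (hclosed : ∀ q ∈ U, ∀ p ∈ P, T.ForestParent A P q p → p ∈ U)
    {q : Finset V} (hq : q ∈ U) :
    ∑ c ∈ T.forestChildren A P U q, T.weight A P U c ≤ T.weight A P U q := by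
  rw [weight_eq hP hclosed hq]
  exact le_add_of_nonneg_left (le_max_right _ _)

theorem card_pathHeap_le_card_redHeap {q : Finset V} (h : ¬ T.IsSupported A P q) :
    99 / 100 * ((T.pathHeap A q).card : ℝ) ≤ ((T.redHeap A P q).card : ℝ) := by
  rw [IsSupported, not_le] at h
  have hsum := Finset.card_filter_add_card_filter_not (s := T.pathHeap A q)
    (fun v => ∃ q' ∈ T.TallChain A P q, v ∈ q')
  simp only [not_exists, not_and] at hsum
  rw [redHeap]
  have hsum' := congrArg (Nat.cast (R := ℝ)) hsum
  push_cast at hsum'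
  linarith

/-- The size of an unsupported short path is small compared to the root of its weight. -/
theorem card_le_sqrt_weight (hP : T.IsPathDecomp P)
    (hclosed : ∀ q ∈ U, ∀ p ∈ P, T.ForestParent A P q p → p ∈ U) {q : Finset V} (hq : q ∈ U)
    (hqP : q ∈ P) (hs : T.IsShort A q) (hns : ¬ T.IsSupported A P q) :
    80 ≤ √(T.weight A P U q : ℝ) ∧ (q.card : ℝ) ≤ √(T.weight A P U q : ℝ) / 80 := by
  have hpos : (1 : ℝ) ≤ q.card := by
    exact_mod_cast Finset.card_pos.mpr ⟨_, (hP.1 q hqP).base_spec.1⟩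
  have hred := card_pathHeap_le_card_redHeap hns
  have hw : ((T.redHeap A P q).card : ℝ) ≤ (T.weight A P U q : ℝ) := by
    exact_mod_cast card_redHeap_le_weight hP hclosed hq
  rw [IsShort] at hs
  have hle : 80 / 100 * √((T.pathHeap A q).card : ℝ) ≤ √(T.weight A P U q : ℝ) := by
    apply Real.le_sqrt_of_sq_le
    rw [mul_pow, Real.sq_sqrt (Nat.cast_nonneg _)]
    have : (0 : ℝ) ≤ (T.pathHeap A q).card := Nat.cast_nonneg _
    linarith
  constructor <;> linarith

theorem sum_sub_sqrt_le {ι : Type*} (s : Finset ι) (w : ι → ℝ) (W : ℝ) (hw : ∀ i ∈ s, 0 ≤ w i)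
    (hgeo : ∀ i ∈ s, 4 / 3 * w i ≤ W) (hsum : ∑ i ∈ s, w i ≤ W) (hW : 80 ≤ √W) :
    √W / 80 + ∑ i ∈ s, (w i / 20 - √(w i) / 10) ≤ W / 20 - √W / 10 := by
  have hW0 : 0 < √W := by linarith
  have hWW : √W * √W = W := Real.mul_self_sqrt (Real.sqrt_pos.mp hW0).le
  have hterm : ∀ i ∈ s, w i / 20 - √(w i) / 10 ≤ w i * (1 / 20 - 9 / 80 / √W) := by
    intro i hi
    have h0 := Real.sqrt_nonneg (w i)
    have hii : √(w i) * √(w i) = w i := Real.mul_self_sqrt (hw i hi)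
    have h1 : 9 / 8 * √(w i) ≤ √W := by
      apply Real.le_sqrt_of_sq_le
      nlinarith [hgeo i hi, hw i hi]
    have h2 : w i * (9 / 8) ≤ √(w i) * √W := by nlinarith
    have h3 : w i * (9 / 80 / √W) ≤ √(w i) / 10 := by
      rw [mul_div_assoc', div_le_iff₀ hW0]
      linarith
    linarith
  have hcoef : 0 ≤ 1 / 20 - 9 / 80 / √W := by
    rw [sub_nonneg, div_le_iff₀ hW0]
    linarith
  have hall := Finset.sum_le_sum hterm
  rw [← Finset.sum_mul] at hall
  have hprod := mul_le_mul_of_nonneg_right hsum hcoef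
  have hval : W * (1 / 20 - 9 / 80 / √W) = W / 20 - 9 / 80 * √W := by
    nth_rewrite 1 [← hWW]
    field_simp
    nlinarith
  linarith

end RBTree

open RBTree in
/-- for a connected component `U` of the shrub forest of unsupported short
paths of a maximum path decomposition and `p ∈ U` with `p ≠ r(U)`, if
`W_q ≥ (4/3)·W_{q'}` whenever `q` is the parent of `q'` in `U` with `q, q' ∈ U_p`, then
`Σ_{q ∈ U_p} |q| ≤ W_p / 20`. -/
theorem charge_sum_le_weight {V : Type} [Fintype V] [DecidableEq V]
    (T : RBTree V) (A : T.LeafAssignment) (P : Finset (Finset V))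
    (hP : T.IsMaxPathDecomp A P) (U : Finset (Finset V)) (r : Finset V)
    (hU : T.IsComponent A P U r) (p : Finset V) (hpU : p ∈ U) (hpr : p ≠ r)
    (hgeo : ∀ q ∈ T.usub A P U p, ∀ q' ∈ T.usub A P U p, T.ForestParent A P q q' →
      (4 / 3 : ℝ) * (T.weight A P U q' : ℝ) ≤ (T.weight A P U q : ℝ)) :
    (∑ q ∈ T.usub A P U p, (q.card : ℝ)) ≤ (T.weight A P U p : ℝ) / 20 := by
  obtain ⟨hUP, -, -, -, hshort, hunsup, -, hclosed⟩ := hU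
  have hPd := hP.1
  have hdesc_unsup : ∀ q, T.ForestDesc A P p q → ¬ T.IsSupported A P q := by
    intro q hq
    rcases Relation.ReflTransGen.cases_tail hq with rfl | ⟨d, -, hd⟩
    · exact hunsup q hpU hpr
    · exact hd.2.2.2.2.1
  have hbound : ∀ q, q ∈ U → T.ForestDesc A P p q →
      (∑ s ∈ T.usub A P U q, (s.card : ℝ)) ≤
        (T.weight A P U q : ℝ) / 20 - √(T.weight A P U q : ℝ) / 10 := by
    refine forest_induction hPd hclosed fun q hq ih hpq => ?_
    have hchild : ∀ c ∈ T.forestChildren A P U q, c ∈ U ∧ T.ForestParent A P q c :=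
      fun c hc => Finset.mem_filter.mp hc
    obtain ⟨hlarge, hcard⟩ := card_le_sqrt_weight hPd hclosed hq (hUP hq) (hshort q hq)
      (hdesc_unsup q hpq)
    have hmain := sum_sub_sqrt_le (T.forestChildren A P U q)
      (fun c => (T.weight A P U c : ℝ)) (T.weight A P U q)
      (fun c hc => by
        exact_mod_cast (Int.natCast_nonneg _).trans
          (card_redHeap_le_weight hPd hclosed (hchild c hc).1))
      (fun c hc => hgeo q (Finset.mem_filter.mpr ⟨hq, hpq⟩) c
        (Finset.mem_filter.mpr ⟨(hchild c hc).1, hpq.tail (hchild c hc).2⟩) (hchild c hc).2)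
      (by exact_mod_cast sum_weight_children_le hPd hclosed hq) hlarge
    have hrec := Finset.sum_le_sum fun c hc => ih c hc (hpq.tail (hchild c hc).2)
    rw [sum_usub hPd hclosed hq]
    linarith
  have hfin := hbound p hpU .refl
  have := Real.sqrt_nonneg (T.weight A P U p : ℝ)
  linarith
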